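/- Let (A, α) be a C*-dynamical system. Then α⁻¹(R_α) = R_α; that is, for every x ∈ A one has α(x) ∈ R_α if and only if x ∈ R_α. In particular α(R_α) ⊆ R_α, and the induced endomorphism of the quotient A/R_α sending a + R_α to α(a) + R_α is injective. -/

import Mathlib

open scoped CStarAlgebra in
theorem StarAlgHom.exists_map_eq_zero_norm_sub_le {A B : Type*} [CStarAlgebra A] [CStarAlgebra B]
    (φ : A →⋆ₐ[ℂ] B) (x : A) {ε : ℝ} (hε : 0 < ε) (hx : ‖φ x‖ ≤ ε) :
    ∃ y : A, φ y = 0 ∧ ‖x - y‖ ≤ ε := by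
  have hcont : Continuous φ := map_continuous φ
  have hsa : IsSelfAdjoint (star x * x) := .star_mul_self x
  have hsaφ : IsSelfAdjoint (φ (star x * x)) := hsa.map φ
  have hmax : ∀ t : ℝ, 0 < max t (ε ^ 2) := fun t ↦ lt_max_of_lt_right (by positivity)
  have hf : Continuous fun t : ℝ ↦ ε ^ 2 / max t (ε ^ 2) :=
    continuous_const.div (by fun_prop) fun t ↦ (hmax t).ne'
  set c := cfc (fun t : ℝ ↦ ε ^ 2 / max t (ε ^ 2)) (star x * x) with hc
  have hφc : φ c = 1 := by
    rw [hc, StarAlgHomClass.map_cfc φ _ _ hf.continuousOn hcont hsa hsaφ,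
      ← cfc_const_one ℝ (φ (star x * x))]
    refine cfc_congr fun t ht ↦ ?_
    have : Nontrivial B := nontrivial_of_ne _ _ fun h : (1 : B) = 0 ↦ by
      have := subsingleton_of_zero_eq_one h.symm
      simp [spectrum.of_subsingleton] at ht
    have ht' : t ≤ ε ^ 2 := calc
      t ≤ ‖t‖ := Real.le_norm_self t
      _ ≤ ‖φ (star x * x)‖ := spectrum.norm_le_norm_of_mem ht
      _ = ‖φ x‖ ^ 2 := by rw [map_mul, map_star, CStarRing.norm_star_mul_self, sq]
      _ ≤ ε ^ 2 := by gcongr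
    simp only [max_eq_right ht']
    exact div_self (by positivity)
  refine ⟨x - x * c, by simp [hφc], ?_⟩
  rw [sub_sub_cancel]
  have hcsa : star c = c := IsSelfAdjoint.star_eq (cfc_predicate _ _)
  have hprod : star (x * c) * (x * c) =
      cfc (fun t : ℝ ↦ ε ^ 2 / max t (ε ^ 2) * (t * (ε ^ 2 / max t (ε ^ 2)))) (star x * x) := by
    rw [cfc_mul _ _ _ hf.continuousOn (by fun_prop), cfc_mul _ _ _ (by fun_prop) hf.continuousOn,
      cfc_id' ℝ (star x * x), ← hc, star_mul, hcsa]
    simp only [mul_assoc]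
  refine le_of_sq_le_sq ?_ hε.le
  rw [sq, ← CStarRing.norm_star_mul_self, hprod]
  refine norm_cfc_le (by positivity) fun t ht ↦ ?_
  have ht0 : 0 ≤ t := spectrum_star_mul_self_nonneg t ht
  have hm := hmax t
  have h1 : ε ^ 2 / max t (ε ^ 2) ≤ 1 := (div_le_one hm).2 (le_max_right _ _)
  have h0 : 0 ≤ ε ^ 2 / max t (ε ^ 2) := by positivity
  have h2 : t * (ε ^ 2 / max t (ε ^ 2)) ≤ ε ^ 2 := by
    rw [mul_div_assoc', div_le_iff₀ hm, mul_comm]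
    gcongr
    exact le_max_left _ _
  rw [Real.norm_of_nonneg (by positivity)]
  exact (mul_le_of_le_one_left (by positivity) h1).trans h2

theorem StarAlgHom.exists_coe_eq_iterate {R A : Type*} [CommSemiring R] [Semiring A] [Algebra R A]
    [Star A] (α : A →⋆ₐ[R] A) (n : ℕ) : ∃ φ : A →⋆ₐ[R] A, ⇑φ = (⇑α)^[n] := by
  induction n with
  | zero => exact ⟨StarAlgHom.id R A, rfl⟩
  | succ n ih =>
    obtain ⟨φ, hφ⟩ := ih
    exact ⟨φ.comp α, by rw [Function.iterate_succ, ← hφ]; rfl⟩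

theorem StarAlgHom.mem_closure_iUnion_ker_iterate_of_map_mem {A : Type*} [CStarAlgebra A]
    (α : A →⋆ₐ[ℂ] A) {x : A} (hx : α x ∈ closure (⋃ k : ℕ, {x : A | (⇑α)^[k + 1] x = 0})) :
    x ∈ closure (⋃ k : ℕ, {x : A | (⇑α)^[k + 1] x = 0}) := by
  rw [Metric.mem_closure_iff] at hx ⊢
  intro ε hε
  obtain ⟨y, hy, hxy⟩ := hx (ε / 2) (half_pos hε)
  obtain ⟨k, hk⟩ := Set.mem_iUnion.1 hy
  obtain ⟨φ, hφ⟩ := α.exists_coe_eq_iterate (k + 1)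
  have hφy : φ y = 0 := by rw [hφ]; exact hk
  have hnorm : ‖φ.comp α x‖ ≤ ε / 2 := calc
    ‖φ (α x)‖ = ‖φ (α x - y)‖ := by rw [map_sub, hφy, sub_zero]
    _ ≤ ‖α x - y‖ := NonUnitalStarAlgHom.norm_apply_le φ _
    _ ≤ ε / 2 := by rw [← dist_eq_norm]; exact hxy.le
  obtain ⟨z, hz, hxz⟩ := (φ.comp α).exists_map_eq_zero_norm_sub_le x (half_pos hε) hnorm
  refine ⟨z, Set.mem_iUnion.2 ⟨k + 1, ?_⟩, ?_⟩
  · rw [Set.mem_ofPred_eq, Function.iterate_succ_apply, ← hφ]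
    exact hz
  · rw [dist_eq_norm]
    exact hxz.trans_lt (half_lt_self hε)

open scoped CStarAlgebra in
theorem StarAlgHom.map_mem_closure_iUnion_ker_iterate {A : Type*} [CStarAlgebra A]
    (α : A →⋆ₐ[ℂ] A) {x : A} (hx : x ∈ closure (⋃ k : ℕ, {x : A | (⇑α)^[k + 1] x = 0})) :
    α x ∈ closure (⋃ k : ℕ, {x : A | (⇑α)^[k + 1] x = 0}) := by
  refine map_mem_closure (map_continuous α) hx fun y hy ↦ ?_
  obtain ⟨k, hk⟩ := Set.mem_iUnion.1 hy
  refine Set.mem_iUnion.2 ⟨k, ?_⟩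
  rw [Set.mem_ofPred_eq] at hk ⊢
  rw [← Function.iterate_succ_apply, Function.iterate_succ_apply', hk, map_zero]

/-- For any C*-dynamical system `(A, α)`, with `R_α` the closure of `⋃_{k ≥ 1} ker(α^k)`,
one has `α⁻¹(R_α) = R_α` (i.e. `α(x) ∈ R_α ↔ x ∈ R_α`); in particular `α(R_α) ⊆ R_α` and
the induced endomorphism of `A/R_α` is injective (i.e. `α(x) ∈ R_α → x ∈ R_α`). -/
theorem preimage_radical_eq_radical
    (A : Type*) [CStarAlgebra A] (α : A →⋆ₐ[ℂ] A) :
    (⇑α) ⁻¹' closure (⋃ k : ℕ, {x : A | (⇑α)^[k + 1] x = 0}) =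
        closure (⋃ k : ℕ, {x : A | (⇑α)^[k + 1] x = 0}) ∧
      (⇑α) '' closure (⋃ k : ℕ, {x : A | (⇑α)^[k + 1] x = 0}) ⊆
        closure (⋃ k : ℕ, {x : A | (⇑α)^[k + 1] x = 0}) ∧
      ∀ x : A, α x ∈ closure (⋃ k : ℕ, {x : A | (⇑α)^[k + 1] x = 0}) →
        x ∈ closure (⋃ k : ℕ, {x : A | (⇑α)^[k + 1] x = 0}) :=
  ⟨Set.ext fun _ ↦ ⟨α.mem_closure_iUnion_ker_iterate_of_map_mem,
      α.map_mem_closure_iUnion_ker_iterate⟩,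
    Set.image_subset_iff.2 fun _ ↦ α.map_mem_closure_iUnion_ker_iterate,
    fun _ ↦ α.mem_closure_iUnion_ker_iterate_of_map_mem⟩
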